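/- Let d ≥ 1. Augment q, k ∈ ℝ^d as q̂ = (q, 1, 0) ∈ ℝ^{d+2} and k̂ = (k, 0, 1) ∈ ℝ^{d+2}, and let A_h = −β_h · e_{d+2} e_{d+1}ᵀ ∈ ℝ^{(d+2)×(d+2)} for a slope β_h ∈ ℝ. Then A_h² = 0, (I + m A_h)⁻¹ᵀ = I − m A_hᵀ for every m ∈ ℤ, and q̂ᵀ (I − m A_hᵀ) k̂ = qᵀ k + m β_h. In particular, with m = j − i the attention logit equals the ALiBi-biased score qᵀk + (j − i)β_h. -/

import Mathlib

open Matrix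

/-- Augment `q, k ∈ ℝ^d` as `q̂ = (q, 1, 0)` and `k̂ = (k, 0, 1)` in
`ℝ^{d+2}`, and let `A_h = −β_h e_{d+2} e_{d+1}ᵀ`. Then `A_h² = 0`,
`((I + m A_h)⁻¹)ᵀ = I − m A_hᵀ` for every `m ∈ ℤ`, and
`q̂ᵀ (I − m A_hᵀ) k̂ = qᵀk + m β_h`: the ALiBi-biased attention logit. -/
theorem alibi_as_rank1_unipotent
    {d : ℕ} (hd : 1 ≤ d) (q k : Fin d → ℝ) (β : ℝ)
    (qhat khat : Fin (d + 2) → ℝ)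
    (hq : qhat = Fin.append q ![1, 0])
    (hk : khat = Fin.append k ![0, 1])
    (A : Matrix (Fin (d + 2)) (Fin (d + 2)) ℝ)
    (hA : A = (-β) • Matrix.vecMulVec
        (Pi.single (⟨d + 1, by omega⟩ : Fin (d + 2)) 1)
        (Pi.single (⟨d, by omega⟩ : Fin (d + 2)) 1)) :
    A * A = 0
      ∧ (∀ m : ℤ, ((1 + (m : ℝ) • A)⁻¹)ᵀ = 1 - (m : ℝ) • Aᵀ)
      ∧ (∀ m : ℤ, qhat ⬝ᵥ (1 - (m : ℝ) • Aᵀ).mulVec khat = q ⬝ᵥ k + (m : ℝ) * β) := by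
  have hAA : A * A = 0 := by
    rw [hA, Matrix.smul_mul, Matrix.mul_smul, Matrix.vecMulVec_mul_vecMulVec]
    simp [Pi.single_apply]
  refine ⟨hAA, fun m => ?_, fun m => ?_⟩
  · have h : (1 + (m : ℝ) • A)⁻¹ = 1 - (m : ℝ) • A := by
      apply Matrix.inv_eq_right_inv
      simp [mul_sub, add_mul, hAA]
    rw [h]
    simp
  · have e1 : (⟨d, by omega⟩ : Fin (d + 2)) = Fin.natAdd d (0 : Fin 2) := by ext; simp
    have e2 : (⟨d + 1, by omega⟩ : Fin (d + 2)) = Fin.natAdd d (1 : Fin 2) := by ext; simp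
    have h0 : qhat ⬝ᵥ khat = q ⬝ᵥ k := by
      simp [hq, hk, dotProduct, Fin.sum_univ_add]
    have h1 : qhat ⟨d, by omega⟩ = 1 := by rw [e1, hq, Fin.append_right]; rfl
    have h2 : khat ⟨d + 1, by omega⟩ = 1 := by rw [e2, hk, Fin.append_right]; rfl
    rw [Matrix.sub_mulVec, dotProduct_sub, Matrix.one_mulVec, h0, hA]
    simp [Matrix.transpose_smul, Matrix.transpose_vecMulVec, Matrix.smul_mulVec,
      Matrix.neg_mulVec, Matrix.vecMulVec_mulVec, h1, h2]
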